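/- Let X ⊆ Y be finite metric spaces with X nonempty and |Y| ≥ k+1 for some k ∈ ℕ, and let c, ε, δ ≥ 0 satisfy δ ≥ 2·h(Y,X) and N_k(X,Y) − ε ≤ c ≤ δ. Let s₀ = 0 < s₁ < ⋯ < s_U be the phase change numbers of X and let M ≤ U be an index such that V_s(X) is connected for all s ≥ s_M. If c + ε + δ < s_{i+1} − s_i for all 0 ≤ i < M, then Λ(L₀X[c]) is a retract of Λ(L_kY): there exist order-preserving maps ι : Λ(L₀X[c]) → Λ(L_kY) and ρ : Λ(L_kY) → Λ(L₀X[c]) with ρ ∘ ι equal to the identity on Λ(L₀X[c]). -/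

import Mathlib

open Metric in
/-- The edge relation at scale `s` of the graph with vertex set `V`
(inside an ambient metric space): an edge between distinct vertices at distance `≤ s`. -/
def adjRel {Y : Type*} [MetricSpace Y] (V : Set Y) (s : ℝ) (a b : Y) : Prop :=
  a ∈ V ∧ b ∈ V ∧ a ≠ b ∧ dist a b ≤ s

/-- Reachability (a path of edges) in the graph with vertex set `V` and edges
between distinct vertices at distance `≤ s`. -/
def Reach {Y : Type*} [MetricSpace Y] (V : Set Y) (s : ℝ) (a b : Y) : Prop :=
  Relation.ReflTransGen (adjRel V s) a b

/-- `S` is (the vertex set of) a connected component of the graph with vertex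
set `V` and edges between distinct vertices at distance `≤ s`.
For `V = X` this graph is the Vietoris–Rips graph `V_s(X)`. -/
def IsCC {Y : Type*} [MetricSpace Y] (V : Set Y) (s : ℝ) (S : Set Y) : Prop :=
  ∃ a ∈ V, S = {b | Reach V s a b}

/-- The vertex set of the Lesnick graph `L_{s,k}(Y)`: the points of `Y` having at
least `k` distinct `s`-neighbours in `Y`. -/
def lesnickVerts (Y : Type*) [MetricSpace Y] (k : ℕ) (s : ℝ) : Set Y :=
  {y | k ≤ Set.ncard {y' : Y | y' ≠ y ∧ dist y y' ≤ s}}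

/-- The directional Hausdorff distance `h(Y, X) = max_{y ∈ Y} min_{x ∈ X} d(y, x)`. -/
noncomputable def dirHaus {Y : Type*} [MetricSpace Y] (X : Set Y) : ℝ :=
  ⨆ y : Y, ⨅ x : X, dist y (x : Y)

/-- `N_k(X, Y) = max_{x ∈ X} min_S max_{y ∈ S} d(x, y)`, the minimum over all
`(k+1)`-element subsets `S ⊆ Y`. -/
noncomputable def Nk {Y : Type*} [MetricSpace Y] (k : ℕ) (X : Set Y) : ℝ :=
  ⨆ x : X, ⨅ S : {S : Finset Y // S.card = k + 1}, ⨆ y : (S : Finset Y), dist (x : Y) (y : Y)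

/-- The poset `Λ(L₀X[c])` of layer points of the truncated Vietoris–Rips clustering:
pairs `(s, S)` with `s ≥ c`, `S` a connected component of `V_s(X)`, and `S` not a
component of `V_r(X)` for any `c ≤ r < s`; ordered as a subset of `ℝ × Set Y`
(componentwise: `≤` on parameters and `⊆` on clusters). `Λ(L₀X) = Λ(L₀X[0])`. -/
def LambdaVR {Y : Type*} [MetricSpace Y] (X : Set Y) (c : ℝ) : Set (ℝ × Set Y) :=
  {p | c ≤ p.1 ∧ IsCC X p.1 p.2 ∧ ∀ r : ℝ, c ≤ r → r < p.1 → ¬ IsCC X r p.2}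

/-- The poset `Λ(L_kY)` of layer points of the Lesnick clustering of `Y`:
pairs `(t, T)` with `t ≥ 0`, `T` a connected component of `L_{t,k}(Y)`, and `T` not
a component of `L_{r,k}(Y)` for any `0 ≤ r < t`; ordered componentwise. -/
def LambdaLes (Y : Type*) [MetricSpace Y] (k : ℕ) : Set (ℝ × Set Y) :=
  {p | 0 ≤ p.1 ∧ IsCC (lesnickVerts Y k p.1) p.1 p.2 ∧
    ∀ r : ℝ, 0 ≤ r → r < p.1 → ¬ IsCC (lesnickVerts Y k r) r p.2}

lemma Reach.symm {Y : Type*} [MetricSpace Y] {V : Set Y} {s : ℝ} {a b : Y}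
    (h : Reach V s a b) : Reach V s b a := by
  have hs : Std.Symm (adjRel V s) :=
    ⟨fun a b ⟨ha, hb, hne, hd⟩ => ⟨hb, ha, hne.symm, dist_comm a b ▸ hd⟩⟩
  exact Relation.ReflTransGen.stdSymm.symm _ _ h

lemma Reach.mono {Y : Type*} [MetricSpace Y] {V W : Set Y} {s t : ℝ} {a b : Y}
    (hVW : V ⊆ W) (hst : s ≤ t) (h : Reach V s a b) : Reach W t a b :=
  Relation.ReflTransGen.mono
    (fun _ _ ⟨ha, hb, hne, hd⟩ => ⟨hVW ha, hVW hb, hne, hd.trans hst⟩) _ _ h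

lemma Reach.mem {Y : Type*} [MetricSpace Y] {V : Set Y} {s : ℝ} {a b : Y}
    (h : Reach V s a b) (ha : a ∈ V) : b ∈ V := by
  induction h with
  | refl => exact ha
  | tail _ h _ => exact h.2.1

/-- A map moving points by at most `δ / 2` sends paths at scale `s` to paths at scale `s + δ`. -/
lemma Reach.map {Y : Type*} [MetricSpace Y] {V W : Set Y} {s δ : ℝ} {f : Y → Y}
    (hfW : ∀ y, f y ∈ W) (hf : ∀ y, dist y (f y) ≤ δ / 2) {a b : Y} (h : Reach V s a b) :
    Reach W (s + δ) (f a) (f b) := by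
  induction h with
  | refl => exact .refl
  | @tail b d _ hbd ih =>
    by_cases hne : f b = f d
    · exact hne ▸ ih
    · refine ih.tail ⟨hfW b, hfW d, hne, ?_⟩
      have h1 := dist_triangle4 (f b) b d (f d)
      have h2 := hf b
      rw [dist_comm] at h2
      linarith [hf d, hbd.2.2.2]

lemma IsCC.nonempty {Y : Type*} [MetricSpace Y] {V S : Set Y} {s : ℝ} (h : IsCC V s S) :
    S.Nonempty := by
  obtain ⟨a, _, rfl⟩ := h
  exact ⟨a, .refl⟩

lemma IsCC.subset_verts {Y : Type*} [MetricSpace Y] {V S : Set Y} {s : ℝ} (h : IsCC V s S) :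
    S ⊆ V := by
  obtain ⟨a, ha, rfl⟩ := h
  exact fun b hb => Reach.mem hb ha

lemma IsCC.reach {Y : Type*} [MetricSpace Y] {V S : Set Y} {s : ℝ} (h : IsCC V s S) {a b : Y}
    (ha : a ∈ S) (hb : b ∈ S) : Reach V s a b := by
  obtain ⟨x, _, rfl⟩ := h
  exact Relation.ReflTransGen.trans (Reach.symm ha) hb

lemma IsCC.mem_of_reach {Y : Type*} [MetricSpace Y] {V S : Set Y} {s : ℝ} (h : IsCC V s S)
    {a b : Y} (ha : a ∈ S) (hab : Reach V s a b) : b ∈ S := by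
  obtain ⟨x, _, rfl⟩ := h
  exact Relation.ReflTransGen.trans ha hab

lemma IsCC.subset_of_mem {Y : Type*} [MetricSpace Y] {V W S T : Set Y} {s t : ℝ}
    (hS : IsCC V s S) (hT : IsCC W t T) (hVW : V ⊆ W) (hst : s ≤ t) {x : Y}
    (hxS : x ∈ S) (hxT : x ∈ T) : S ⊆ T :=
  fun _ hy => hT.mem_of_reach hxT ((hS.reach hxS hy).mono hVW hst)

/-- A set that is a component at two scales is a component at every scale in between. -/
lemma IsCC.of_between {Y : Type*} [MetricSpace Y] {V : ℝ → Set Y} (hV : Monotone V) {T : Set Y}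
    {r s t : ℝ} (hr : IsCC (V r) r T) (ht : IsCC (V t) t T) (hrs : r ≤ s) (hst : s ≤ t) :
    IsCC (V s) s T := by
  obtain ⟨a, ha⟩ := hr.nonempty
  have haV := hV hrs (hr.subset_verts ha)
  have hcc : IsCC (V s) s {b | Reach (V s) s a b} := ⟨a, haV, rfl⟩
  have h1 := hr.subset_of_mem hcc (hV hrs) hrs ha .refl
  have h2 := hcc.subset_of_mem ht (hV hst) hst .refl ha
  exact h1.antisymm h2 ▸ hcc

lemma IsCC.congr {Y : Type*} [MetricSpace Y] {V S : Set Y} {r s : ℝ}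
    (h : ∀ a ∈ V, ∀ b ∈ V, dist a b ≤ r ↔ dist a b ≤ s) (hS : IsCC V r S) : IsCC V s S := by
  have he : adjRel V r = adjRel V s := by
    ext a b
    constructor
    · rintro ⟨ha, hb, hne, hd⟩
      exact ⟨ha, hb, hne, (h a ha b hb).1 hd⟩
    · rintro ⟨ha, hb, hne, hd⟩
      exact ⟨ha, hb, hne, (h a ha b hb).2 hd⟩
  unfold IsCC Reach at *
  rwa [he] at hS

/-- `r` is the least scale `≥ c` at which `S` is a component of the filtered graph on `V`. -/
def IsBirth {Y : Type*} [MetricSpace Y] (V : ℝ → Set Y) (c : ℝ) (S : Set Y) (r : ℝ) : Prop :=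
  c ≤ r ∧ IsCC (V r) r S ∧ ∀ r' : ℝ, c ≤ r' → r' < r → ¬ IsCC (V r') r' S

lemma exists_isBirth {Y : Type*} [MetricSpace Y] [Finite Y] {V : ℝ → Set Y}
    (hV : ∀ r s, (∀ a b : Y, dist a b ≤ r ↔ dist a b ≤ s) → V r = V s)
    {c s : ℝ} (hcs : c ≤ s) {S : Set Y} (hS : IsCC (V s) s S) :
    ∃ r ≤ s, IsBirth V c S r := by
  set D : Set ℝ := insert c (Set.range fun p : Y × Y => dist p.1 p.2) with hD
  have hDfin : D.Finite := (Set.finite_range _).insert c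
  have hfloor : ∀ t, c ≤ t → IsCC (V t) t S → ∃ r ∈ D, c ≤ r ∧ r ≤ t ∧ IsCC (V r) r S := by
    intro t hct ht
    obtain ⟨r, ⟨hrD, hrt⟩, hmax⟩ := Set.exists_max_image (D ∩ Set.Iic t) id
      (hDfin.subset Set.inter_subset_left) ⟨c, Set.mem_insert _ _, hct⟩
    have hiff : ∀ a b : Y, dist a b ≤ t ↔ dist a b ≤ r := fun a b =>
      ⟨fun h => hmax _ ⟨Set.mem_insert_of_mem _ ⟨(a, b), rfl⟩, h⟩, fun h => h.trans hrt⟩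
    refine ⟨r, hrD, hmax c ⟨Set.mem_insert _ _, hct⟩, hrt, ?_⟩
    rw [← hV t r hiff]
    exact ht.congr fun a _ b _ => hiff a b
  obtain ⟨r₀, hr₀D, hcr₀, hr₀s, hr₀⟩ := hfloor s hcs hS
  obtain ⟨r, ⟨hrD, hcr, hr⟩, hmin⟩ := Set.exists_min_image
    (D ∩ {r | c ≤ r ∧ IsCC (V r) r S}) id
    (hDfin.subset Set.inter_subset_left) ⟨r₀, hr₀D, hcr₀, hr₀⟩
  refine ⟨r, (hmin r₀ ⟨hr₀D, hcr₀, hr₀⟩).trans hr₀s, hcr, hr, fun r' hcr' hlt hr' => ?_⟩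
  obtain ⟨r₁, hr₁D, hcr₁, hr₁r', hr₁⟩ := hfloor r' hcr' hr'
  exact absurd (hmin r₁ ⟨hr₁D, hcr₁, hr₁⟩) (not_le.2 (hr₁r'.trans_lt hlt))

lemma IsBirth.unique {Y : Type*} [MetricSpace Y] {V : ℝ → Set Y} {c r r' : ℝ} {S : Set Y}
    (h : IsBirth V c S r) (h' : IsBirth V c S r') : r = r' :=
  le_antisymm (not_lt.1 fun hlt => h.2.2 r' h'.1 hlt h'.2.1)
    (not_lt.1 fun hlt => h'.2.2 r h.1 hlt h.2.1)

lemma IsBirth.le {Y : Type*} [MetricSpace Y] {V : ℝ → Set Y} (hV : Monotone V)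
    {c s t r q : ℝ} {S T : Set Y} (hS : IsCC (V s) s S) (hT : IsCC (V t) t T) (hst : s ≤ t)
    (hST : S ⊆ T) (hr : IsBirth V c S r) (hrs : r ≤ s) (hq : IsBirth V c T q) : r ≤ q := by
  by_contra! hlt
  have hTs := hq.2.1.of_between hV hT (hlt.le.trans hrs) hst
  obtain ⟨a, ha⟩ := hS.nonempty
  have hTS := hTs.subset_of_mem hS subset_rfl le_rfl (hST ha) ha
  exact hr.2.2 q hq.1 hlt (hST.antisymm hTS ▸ hq.2.1)

lemma lesnickVerts_mono (Y : Type*) [MetricSpace Y] [Finite Y] (k : ℕ) :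
    Monotone (lesnickVerts Y k) := fun _ _ hst _ hy =>
  le_trans hy (Set.ncard_le_ncard (Set.ofPred_subset_ofPred.2 fun _ h => ⟨h.1, h.2.trans hst⟩)
    (Set.toFinite _))

lemma lesnickVerts_congr (Y : Type*) [MetricSpace Y] (k : ℕ) (r s : ℝ)
    (h : ∀ a b : Y, dist a b ≤ r ↔ dist a b ≤ s) :
    lesnickVerts Y k r = lesnickVerts Y k s := by
  simp only [lesnickVerts, h]

lemma exists_dist_le_dirHaus {Y : Type*} [MetricSpace Y] [Finite Y] {X : Set Y}
    (hX : X.Nonempty) (y : Y) : ∃ x ∈ X, dist y x ≤ dirHaus X := by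
  have : Nonempty X := hX.to_subtype
  obtain ⟨x, hx⟩ := exists_eq_ciInf_of_finite (f := fun x : X => dist y (x : Y))
  refine ⟨x, x.2, hx.trans_le ?_⟩
  exact le_ciSup (f := fun y : Y => ⨅ x : X, dist y (x : Y)) (Set.finite_range _).bddAbove y

lemma subset_lesnickVerts {Y : Type*} [MetricSpace Y] [Fintype Y] {k : ℕ} {X : Set Y}
    (hcard : k + 1 ≤ Fintype.card Y) {s : ℝ} (hs : Nk k X ≤ s) : X ⊆ lesnickVerts Y k s := by
  classical
  intro x hx
  have : Nonempty {S : Finset Y // S.card = k + 1} := by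
    obtain ⟨S, -, hS⟩ := Finset.exists_subset_card_eq (s := (Finset.univ : Finset Y)) hcard
    exact ⟨⟨S, hS⟩⟩
  obtain ⟨S, hS⟩ := exists_eq_ciInf_of_finite
    (f := fun S : {S : Finset Y // S.card = k + 1} => ⨆ y : (S : Finset Y), dist x (y : Y))
  have hle : (⨆ y : (S : Finset Y), dist x (y : Y)) ≤ s := by
    refine (hS.trans_le ?_).trans hs
    exact le_ciSup (f := fun x : X => ⨅ S : {S : Finset Y // S.card = k + 1},
      ⨆ y : (S : Finset Y), dist (x : Y) (y : Y)) (Set.finite_range _).bddAbove ⟨x, hx⟩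
  have hd : ∀ y ∈ (S : Finset Y), dist x y ≤ s := fun y hy =>
    (le_ciSup (f := fun y : (S : Finset Y) => dist x (y : Y))
      (Set.finite_range _).bddAbove ⟨y, hy⟩).trans hle
  have hsub : ((S : Finset Y).erase x : Set Y) ⊆ {y' : Y | y' ≠ x ∧ dist x y' ≤ s} := by
    intro y hy
    have hy' := Finset.mem_erase.1 (Finset.mem_coe.1 hy)
    exact ⟨hy'.1, hd y hy'.2⟩
  have h1 := Set.ncard_le_ncard hsub (Set.toFinite _)
  rw [Set.ncard_coe_finset] at h1
  have h2 := Finset.pred_card_le_card_erase (s := (S : Finset Y)) (a := x)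
  have h3 := S.2
  change k ≤ _
  omega

/-- If consecutive phase change numbers are far apart, then a layer point of the truncated
Vietoris–Rips clustering remains a component after increasing the scale by `η`. -/
lemma IsBirth.isCC_add {Y : Type*} [MetricSpace Y] {X S : Set Y} {c η s : ℝ}
    (hc : 0 ≤ c) (hη : 0 ≤ η) {U M : ℕ} {σ : ℕ → ℝ} (hσ0 : σ 0 = 0)
    (hσmono : ∀ i j : ℕ, i < j → j ≤ U → σ i < σ j)
    (hσrange : {r : ℝ | ∃ x ∈ X, ∃ x' ∈ X, r = dist x x'} = σ '' {i : ℕ | i ≤ U})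
    (hMU : M ≤ U) (hconn : ∀ s : ℝ, σ M ≤ s → IsCC X s X)
    (hgap : ∀ i : ℕ, i < M → c + η < σ (i + 1) - σ i)
    (h : IsBirth (fun _ => X) c S s) : IsCC X (s + η) S := by
  obtain ⟨hcs, hS, hmin⟩ := h
  rcases le_or_gt (σ M) s with hMs | hsM
  · obtain ⟨a, ha⟩ := hS.nonempty
    have haX := hS.subset_verts ha
    have hXS := (hconn s hMs).subset_of_mem hS subset_rfl le_rfl haX ha
    rw [hS.subset_verts.antisymm hXS]
    exact hconn _ (by linarith)
  · obtain ⟨i, hiM, his, hsi⟩ : ∃ i < M, σ i ≤ s ∧ s < σ (i + 1) := by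
      by_contra! hcon
      have : ∀ i ≤ M, σ i ≤ s := by
        intro i
        induction i with
        | zero => intro _; rw [hσ0]; exact hc.trans hcs
        | succ i ih => exact fun hi => hcon i hi (ih (Nat.le_of_succ_le hi))
      exact absurd (this M le_rfl) (not_le.2 hsM)
    have hiff : ∀ r t, σ i ≤ r → r < σ (i + 1) → σ i ≤ t → t < σ (i + 1) →
        ∀ a ∈ X, ∀ b ∈ X, dist a b ≤ r ↔ dist a b ≤ t := by
      intro r t hr hr' ht ht' a ha b hb
      obtain ⟨j, hj, hjd⟩ : dist a b ∈ σ '' {i : ℕ | i ≤ U} :=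
        hσrange ▸ ⟨a, ha, b, hb, rfl⟩
      rw [← hjd]
      have hj' : j ≤ U := hj
      rcases lt_trichotomy j i with hji | rfl | hji
      · have := hσmono j i hji (by omega)
        exact ⟨fun _ => by linarith, fun _ => by linarith⟩
      · exact ⟨fun _ => ht, fun _ => hr⟩
      · have : σ (i + 1) ≤ σ j := by
          rcases Nat.lt_or_ge (i + 1) j with hlt | hge
          · exact (hσmono _ _ hlt hj').le
          · rw [show j = i + 1 by omega]
        exact ⟨fun _ => by linarith, fun _ => by linarith⟩
    have hgi := hgap i hiM
    have hlt : s + η < σ (i + 1) := by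
      rcases hcs.eq_or_lt with rfl | hcs
      · have h0 : 0 ≤ σ i := by
          rcases Nat.eq_zero_or_pos i with rfl | hi
          · exact hσ0.ge
          · exact hσ0 ▸ (hσmono 0 i hi (by omega)).le
        linarith
      · rcases his.eq_or_lt with his' | his'
        · linarith
        · have hm : max (σ i) c < s := max_lt his' hcs
          exact absurd (hS.congr (hiff s _ his hsi (le_max_left _ _) (hm.trans hsi)))
            (hmin _ (le_max_right _ _) hm)
    exact hS.congr (hiff s _ his hsi (by linarith) hlt)

/-- If `δ ≥ 2h(Y,X)`, `N_k(X,Y) − ε ≤ c ≤ δ` and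
`c + ε + δ < s_{i+1} − s_i` for all `i < M` (where `s₀ = 0 < s₁ < ⋯ < s_U` are the
phase change numbers of `X` and `V_s(X)` is connected for `s ≥ s_M`), then
`Λ(L₀X[c])` is a retract of `Λ(L_kY)`. -/
theorem statement14 {Y : Type*} [MetricSpace Y] [Fintype Y] (k : ℕ) (X : Set Y)
    (hX : X.Nonempty) (hcard : k + 1 ≤ Fintype.card Y)
    (c ε δ : ℝ) (hc : 0 ≤ c) (hε : 0 ≤ ε) (hδ : 0 ≤ δ)
    (hhδ : 2 * dirHaus X ≤ δ) (hNc : Nk k X - ε ≤ c) (hcδ : c ≤ δ)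
    (U M : ℕ) (σ : ℕ → ℝ) (hσ0 : σ 0 = 0)
    (hσmono : ∀ i j : ℕ, i < j → j ≤ U → σ i < σ j)
    (hσrange : {r : ℝ | ∃ x ∈ X, ∃ x' ∈ X, r = dist x x'} = σ '' {i : ℕ | i ≤ U})
    (hMU : M ≤ U)
    (hconn : ∀ s : ℝ, σ M ≤ s → IsCC X s X)
    (hgap : ∀ i : ℕ, i < M → c + ε + δ < σ (i + 1) - σ i) :
    ∃ (ι : LambdaVR X c → LambdaLes Y k) (ρ : LambdaLes Y k → LambdaVR X c),
      Monotone ι ∧ Monotone ρ ∧ ∀ a, ρ (ι a) = a := by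
  have hpi : ∀ y : Y, ∃ x ∈ X, dist y x ≤ δ / 2 ∧ (y ∈ X → x = y) := by
    intro y
    by_cases hy : y ∈ X
    · exact ⟨y, hy, by rw [dist_self]; linarith, fun _ => rfl⟩
    · obtain ⟨x, hx, hd⟩ := exists_dist_le_dirHaus hX y
      exact ⟨x, hx, by linarith, fun h => absurd h hy⟩
  choose π hπX hπd hπid using hpi
  have hι : ∀ p : LambdaVR X c, ∃ q : LambdaLes Y k, q.1.1 ≤ p.1.1 + ε ∧ p.1.2 ⊆ q.1.2 ∧
      IsCC (lesnickVerts Y k (p.1.1 + ε)) (p.1.1 + ε) q.1.2 := by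
    rintro ⟨⟨s, S⟩, hcs, hS, -⟩
    dsimp only at hcs hS ⊢
    obtain ⟨a, ha⟩ := hS.nonempty
    have hsub : X ⊆ lesnickVerts Y k (s + ε) := subset_lesnickVerts hcard (by linarith)
    have hcc : IsCC (lesnickVerts Y k (s + ε)) (s + ε)
        {b | Reach (lesnickVerts Y k (s + ε)) (s + ε) a b} :=
      ⟨a, hsub (hS.subset_verts ha), rfl⟩
    obtain ⟨r, hr, hb⟩ := exists_isBirth (lesnickVerts_congr Y k) (c := 0) (by linarith) hcc
    exact ⟨⟨(r, _), hb⟩, hr, hS.subset_of_mem hcc hsub (by linarith) ha .refl, hcc⟩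
  have hρ : ∀ q : LambdaLes Y k, ∃ p : LambdaVR X c, p.1.1 ≤ q.1.1 + δ ∧
      (∀ y ∈ q.1.2, π y ∈ p.1.2) ∧ IsCC X (q.1.1 + δ) p.1.2 := by
    rintro ⟨⟨t, T⟩, ht, hT, -⟩
    dsimp only at ht hT ⊢
    obtain ⟨a, ha⟩ := hT.nonempty
    have hcc : IsCC X (t + δ) {b | Reach X (t + δ) (π a) b} := ⟨π a, hπX a, rfl⟩
    obtain ⟨r, hr, hb⟩ := exists_isBirth (V := fun _ => X) (fun _ _ _ => rfl) (c := c)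
      (by linarith) hcc
    exact ⟨⟨(r, _), hb⟩, hr, fun y hy => (hT.reach ha hy).map hπX hπd, hcc⟩
  choose ι hι1 hι2 hι3 using hι
  choose ρ hρ1 hρ2 hρ3 using hρ
  refine ⟨ι, ρ, fun p p' hpp => ?_, fun q q' hqq => ?_, fun p => ?_⟩
  · have hs : p.1.1 + ε ≤ p'.1.1 + ε := add_le_add_left hpp.1 ε
    obtain ⟨a, ha⟩ := p.2.2.1.nonempty
    have hsub := (hι3 p).subset_of_mem (hι3 p') (lesnickVerts_mono Y k hs) hs
      (hι2 p ha) (hι2 p' (hpp.2 ha))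
    exact ⟨IsBirth.le (lesnickVerts_mono Y k) (hι3 p) (hι3 p') hs hsub (ι p).2 (hι1 p) (ι p').2,
      hsub⟩
  · have ht : q.1.1 + δ ≤ q'.1.1 + δ := add_le_add_left hqq.1 δ
    obtain ⟨a, ha⟩ := q.2.2.1.nonempty
    have hsub := (hρ3 q).subset_of_mem (hρ3 q') subset_rfl ht
      (hρ2 q a ha) (hρ2 q' a (hqq.2 ha))
    exact ⟨IsBirth.le (V := fun _ => X) monotone_const (hρ3 q) (hρ3 q') ht hsub
      (ρ q).2 (hρ1 q) (ρ q').2, hsub⟩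
  · have hstab : IsCC X (p.1.1 + (ε + δ)) p.1.2 :=
      IsBirth.isCC_add hc (by linarith) hσ0 hσmono hσrange hMU hconn
        (fun i hi => by linarith [hgap i hi]) p.2
    have hsub : p.1.2 ⊆ (ρ (ι p)).1.2 := fun x hx =>
      hπid x (p.2.2.1.subset_verts hx) ▸ hρ2 (ι p) x (hι2 p hx)
    obtain ⟨a, ha⟩ := p.2.2.1.nonempty
    have hsub' := (hρ3 (ι p)).subset_of_mem hstab subset_rfl
      (by linarith [hι1 p]) (hsub ha) ha
    have hS : (ρ (ι p)).1.2 = p.1.2 := hsub'.antisymm hsub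
    have hb : IsBirth (fun _ => X) c p.1.2 (ρ (ι p)).1.1 := hS ▸ (ρ (ι p)).2
    exact Subtype.ext (Prod.ext (hb.unique p.2) hS)
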